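/- arXiv:1204.2736 — 5 statements merged into one kernel-verified Lean document; each statement's English description precedes it below -/
import Mathlib

section
/- The matrix M^P is positive semidefinite for every N ≥ 1 and every time grid 0 = t_0 < t_1 < … < t_N if and only if 2ρ_t − η_t ≥ 0 for all t ≥ 0. -/
open MeasureTheory Filter

/-- The block-shape model-P impact matrix `M^P`. -/
noncomputable def MP (ρ lam : ℝ → ℝ) (N : ℕ) (t : ℕ → ℝ) :
    Matrix (Fin (N + 1)) (Fin (N + 1)) ℝ := fun i j =>
  Real.exp (-|∫ s in (t i.val)..(t j.val), ρ s|) / lam (min (t i.val) (t j.val))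

/-- The squared cumulative resilience factor divided by the depth; model-P impact is, up to
congruence, the covariance matrix of a process with this variance and independent increments. -/
noncomputable def scaledVariance (ρ lam : ℝ → ℝ) (u : ℝ) : ℝ :=
  Real.exp (2 * ∫ s in (0 : ℝ)..u, ρ s) / lam u

lemma exp_neg_abs_integral_div_eq {ρ lam : ℝ → ℝ} (hρ : Continuous ρ)
    (hρpos : ∀ s, 0 ≤ s → 0 < ρ s) {u v : ℝ} (hu : 0 ≤ u) (hv : 0 ≤ v) :
    Real.exp (-|∫ s in u..v, ρ s|) / lam (min u v) =
      Real.exp (-∫ s in (0 : ℝ)..u, ρ s) * Real.exp (-∫ s in (0 : ℝ)..v, ρ s) *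
        scaledVariance ρ lam (min u v) := by
  wlog h : u ≤ v generalizing u v
  · rw [intervalIntegral.integral_symm, abs_neg, min_comm, this hv hu (le_of_not_ge h)]
    ring
  have hnonneg : 0 ≤ ∫ s in u..v, ρ s :=
    intervalIntegral.integral_nonneg h fun s hs => (hρpos s (hu.trans hs.1)).le
  have hadd := intervalIntegral.integral_add_adjacent_intervals
    (hρ.intervalIntegrable (μ := volume) 0 u) (hρ.intervalIntegrable u v)
  rw [abs_of_nonneg hnonneg, min_eq_left h, scaledVariance, ← hadd, mul_div_assoc',
    ← Real.exp_add, ← Real.exp_add]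
  ring_nf

lemma hasDerivAt_scaledVariance {ρ lam : ℝ → ℝ} (hρ : Continuous ρ)
    (hlam : Differentiable ℝ lam) {u : ℝ} (hu : 0 < lam u) :
    HasDerivAt (scaledVariance ρ lam)
      (scaledVariance ρ lam u * (2 * ρ u - deriv lam u / lam u)) u := by
  have hint : HasDerivAt (fun x => ∫ s in (0 : ℝ)..x, ρ s) (ρ u) u :=
    intervalIntegral.integral_hasDerivAt_right (hρ.intervalIntegrable 0 u)
      hρ.stronglyMeasurable.stronglyMeasurableAtFilter hρ.continuousAt
  refine ((hint.const_mul 2).exp.div (hlam u).hasDerivAt hu.ne').congr_deriv ?_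
  rw [scaledVariance]
  field_simp

lemma monotoneOn_scaledVariance_iff {ρ lam : ℝ → ℝ} (hρ : Continuous ρ)
    (hlam : Differentiable ℝ lam) (hlampos : ∀ s, 0 ≤ s → 0 < lam s) :
    MonotoneOn (scaledVariance ρ lam) (Set.Ici 0) ↔
      ∀ s, 0 ≤ s → 0 ≤ 2 * ρ s - deriv lam s / lam s := by
  have hderiv : ∀ s, 0 ≤ s → HasDerivAt (scaledVariance ρ lam) _ s := fun s hs =>
    hasDerivAt_scaledVariance hρ hlam (hlampos s hs)
  have hpos : ∀ s, 0 ≤ s → 0 < scaledVariance ρ lam s := fun s hs =>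
    div_pos (Real.exp_pos _) (hlampos s hs)
  constructor
  · intro h s hs
    have hd := h.derivWithin_nonneg (x := s)
    rw [(hderiv s hs).hasDerivWithinAt.derivWithin (uniqueDiffOn_Ici 0 s hs)] at hd
    exact nonneg_of_mul_nonneg_right hd (hpos s hs)
  · intro h
    refine monotoneOn_of_deriv_nonneg (convex_Ici 0)
      (fun s hs => (hderiv s hs).continuousAt.continuousWithinAt) ?_ ?_
    · intro s hs
      exact (hderiv s (interior_subset hs)).differentiableAt.differentiableWithinAt
    · intro s hs
      have hs' : 0 ≤ s := interior_subset hs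
      rw [(hderiv s hs').deriv]
      exact mul_nonneg (hpos s hs').le (h s hs')

/-- A Gram-type matrix `c i * c j * d (min i j)` is positive semidefinite when `d` is nonnegative
and nondecreasing. -/
lemma posSemidef_mul_mul_min {n : ℕ} (c d : ℕ → ℝ) (hd0 : 0 ≤ d 0)
    (hd : ∀ i, i + 1 < n → d i ≤ d (i + 1)) :
    (Matrix.of fun i j : Fin n => c i * c j * d (min i.val j.val)).PosSemidef := by
  let e : ℕ → ℝ := fun k => d k - if k = 0 then 0 else d (k - 1)
  let v : ℕ → Fin n → ℝ := fun k i => if k ≤ i then c i else 0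
  have hsum : ∀ m, ∑ k ∈ Finset.range (m + 1), e k = d m := by
    intro m
    induction m with
    | zero => simp [e]
    | succ m ih => rw [Finset.sum_range_succ, ih]; simp [e]
  have heq : (Matrix.of fun i j : Fin n => c i * c j * d (min i.val j.val)) =
      ∑ k ∈ Finset.range n, e k • Matrix.vecMulVec (v k) (star (v k)) := by
    ext i j
    have hsub : Finset.range (min i.val j.val + 1) ⊆ Finset.range n :=
      Finset.range_subset_range.2 (by omega)
    simp only [Matrix.of_apply, Matrix.sum_apply, Matrix.smul_apply, Matrix.vecMulVec_apply,
      star_trivial, smul_eq_mul]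
    rw [← Finset.sum_subset hsub, ← hsum, Finset.mul_sum]
    · refine Finset.sum_congr rfl fun k hk => ?_
      have hk' := Finset.mem_range.1 hk
      rw [show v k i = c i from if_pos (by omega), show v k j = c j from if_pos (by omega)]
      ring
    · intro k _ hk
      rw [Finset.mem_range, not_lt] at hk
      rcases lt_or_ge i.val k with hi | hi
      · simp [v, hi]
      · simp [v, show j.val < k by omega]
  rw [heq]
  refine Matrix.posSemidef_sum _ fun k hk => (Matrix.posSemidef_vecMulVec_self_star (v k)).smul ?_
  rcases k with _ | k
  · simpa [e] using hd0
  · simpa [e] using hd k (Finset.mem_range.1 hk)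

/-- Testing positivity on a rescaled difference of two coordinate vectors. -/
lemma le_of_posSemidef_of_apply_eq_mul_mul {ι : Type*} [Fintype ι] [DecidableEq ι]
    {M : Matrix ι ι ℝ} (hM : M.PosSemidef) {i j : ι} {p q a b : ℝ} (hp : p ≠ 0) (hq : q ≠ 0)
    (hii : M i i = p * p * a) (hij : M i j = p * q * a) (hji : M j i = q * p * a)
    (hjj : M j j = q * q * b) : a ≤ b := by
  have h := hM.dotProduct_mulVec_nonneg (Pi.single i p⁻¹ - Pi.single j q⁻¹)
  simp only [star_trivial, Matrix.mulVec_sub, sub_dotProduct, dotProduct_sub,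
    single_dotProduct, Matrix.mulVec_single, Pi.smul_apply, Matrix.col_apply, hii, hij, hji, hjj,
    MulOpposite.smul_eq_mul_unop, MulOpposite.unop_op] at h
  field_simp at h
  linarith

lemma nonneg_of_grid {N : ℕ} {t : ℕ → ℝ} (h0 : t 0 = 0) (ht : ∀ i, i < N → t i < t (i + 1)) :
    ∀ i, i ≤ N → 0 ≤ t i := by
  intro i
  induction i with
  | zero => exact fun _ => h0.ge
  | succ i ih => exact fun hi => (ih (by omega)).trans (ht i hi).le

lemma le_of_grid {N : ℕ} {t : ℕ → ℝ} (ht : ∀ i, i < N → t i < t (i + 1)) {i j : ℕ}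
    (hij : i ≤ j) (hj : j ≤ N) : t i ≤ t j := by
  induction j, hij using Nat.le_induction with
  | base => exact le_rfl
  | succ j _ ih => exact (ih (by omega)).trans (ht j hj).le

theorem stmt6 (ρ lam : ℝ → ℝ)
    (hρ : ContDiff ℝ 1 ρ) (hρpos : ∀ s, 0 ≤ s → 0 < ρ s)
    (hlam : ContDiff ℝ 2 lam) (hlampos : ∀ s, 0 ≤ s → 0 < lam s) :
    (∀ N : ℕ, 1 ≤ N → ∀ t : ℕ → ℝ, t 0 = 0 → (∀ i, i < N → t i < t (i + 1)) →
        (MP ρ lam N t).PosSemidef) ↔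
      ∀ s, 0 ≤ s → 0 ≤ 2 * ρ s - deriv lam s / lam s := by
  have hρc := hρ.continuous
  rw [← monotoneOn_scaledVariance_iff hρc (hlam.differentiable (by norm_num)) hlampos]
  have hentry : ∀ {N : ℕ} {t : ℕ → ℝ}, t 0 = 0 → (∀ i, i < N → t i < t (i + 1)) →
      ∀ i j : Fin (N + 1), MP ρ lam N t i j =
        Real.exp (-∫ s in (0 : ℝ)..t i, ρ s) * Real.exp (-∫ s in (0 : ℝ)..t j, ρ s) *
          scaledVariance ρ lam (t (min i.val j.val)) := by
    intro N t h0 ht i j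
    have hmin : min (t i) (t j) = t (min i.val j.val) := by
      rcases le_total i.val j.val with h | h
      · rw [min_eq_left h, min_eq_left (le_of_grid ht h (by omega))]
      · rw [min_eq_right h, min_eq_right (le_of_grid ht h (by omega))]
    rw [← hmin]
    exact exp_neg_abs_integral_div_eq hρc hρpos (nonneg_of_grid h0 ht i (by omega))
      (nonneg_of_grid h0 ht j (by omega))
  constructor
  · intro h
    have hle : ∀ {N : ℕ} {t : ℕ → ℝ}, t 0 = 0 → (∀ i, i < N → t i < t (i + 1)) →
        ∀ i, i < N → scaledVariance ρ lam (t i) ≤ scaledVariance ρ lam (t (i + 1)) := by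
      intro N t h0 ht i hi
      have he := hentry h0 ht
      refine le_of_posSemidef_of_apply_eq_mul_mul (h N (by omega) t h0 ht)
        (i := ⟨i, by omega⟩) (j := ⟨i + 1, by omega⟩)
        (Real.exp_ne_zero (-∫ s in (0 : ℝ)..t i, ρ s))
        (Real.exp_ne_zero (-∫ s in (0 : ℝ)..t (i + 1), ρ s)) ?_ ?_ ?_ ?_ <;> simp [he]
    intro a ha b _ hab
    rcases hab.eq_or_lt with rfl | hab
    · exact le_rfl
    rcases (Set.mem_Ici.1 ha).eq_or_lt with rfl | ha
    · simpa using hle (N := 1) (t := fun k => k * b) (by simp)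
        (fun i _ => by push_cast; linarith) 0 (by omega)
    · have hgrid : ∀ i, i < 2 → (fun k : ℕ => if k = 0 then 0 else if k = 1 then a else b) i <
          (fun k : ℕ => if k = 0 then 0 else if k = 1 then a else b) (i + 1) := by
        intro i hi
        interval_cases i <;> simpa
      simpa using hle (by simp) hgrid 1 (by omega)
  · intro h N _ t h0 ht
    have hnonneg := nonneg_of_grid h0 ht
    have hM : MP ρ lam N t = Matrix.of fun i j : Fin (N + 1) =>
        Real.exp (-∫ s in (0 : ℝ)..t i, ρ s) * Real.exp (-∫ s in (0 : ℝ)..t j, ρ s) *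
          scaledVariance ρ lam (t (min i.val j.val)) := by
      ext i j
      exact hentry h0 ht i j
    rw [hM]
    refine posSemidef_mul_mul_min (fun k => Real.exp (-∫ s in (0 : ℝ)..t k, ρ s))
      (fun k => scaledVariance ρ lam (t k)) ?_ fun i hi => ?_
    · exact (div_pos (Real.exp_pos _) (hlampos _ (hnonneg 0 (by omega)))).le
    · exact h (hnonneg i (by omega)) (hnonneg (i + 1) (by omega)) (ht i (by omega)).le
end

section
/- The function ξ ↦ C^V(ξ, t) on ℝ^{N+1} is continuously differentiable and its partial derivatives satisfy ∂C^V/∂ξ_N = F⁻¹((E_N + ξ_N)/λ(t_N)), and, for every 0 ≤ i ≤ N−1, ∂C^V/∂ξ_i − a_{i+1}·∂C^V/∂ξ_{i+1} = F⁻¹((E_i + ξ_i)/λ(t_i)) − a_{i+1}·F⁻¹(E_{i+1}/λ(t_{i+1})), where E_n is viewed as the function of ξ given by E_n = Σ_{i=0}^{n−1} ξ_i·exp(−∫_{t_i}^{t_n} ρ_u du). -/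
open MeasureTheory Filter

/-- `F(y) = ∫_0^y f(x) dx`. -/
noncomputable def Fint (f : ℝ → ℝ) (y : ℝ) : ℝ := ∫ x in (0:ℝ)..y, f x

/-- `F̃(x) = ∫_0^x y f(y) dy`. -/
noncomputable def Ftil (f : ℝ → ℝ) (x : ℝ) : ℝ := ∫ y in (0:ℝ)..x, y * f y

/-- `G = F̃ ∘ F⁻¹`, where `Finv` plays the role of `F⁻¹`. -/
noncomputable def Gfun (f Finv : ℝ → ℝ) (x : ℝ) : ℝ := Ftil f (Finv x)

/-- `a_i = exp(-∫_{t_{i-1}}^{t_i} ρ_u du)`. -/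
noncomputable def aC (ρ : ℝ → ℝ) (t : ℕ → ℝ) (i : ℕ) : ℝ :=
  Real.exp (-∫ s in (t (i - 1))..(t i), ρ s)

/-- Extension of a trade vector `ξ ∈ ℝ^{N+1}` to an `ℕ`-indexed family (zero beyond `N`). -/
def pad {N : ℕ} (ξ : Fin (N + 1) → ℝ) (n : ℕ) : ℝ := if h : n < N + 1 then ξ ⟨n, h⟩ else 0

/-- `E_n = Σ_{i=0}^{n-1} ξ_i exp(-∫_{t_i}^{t_n} ρ_u du)`, the volume impact before the `n`-th
trade, as a function of the trade vector. -/
noncomputable def Evol (ρ : ℝ → ℝ) (t : ℕ → ℝ) (ξ : ℕ → ℝ) (n : ℕ) : ℝ :=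
  ∑ i ∈ Finset.range n, ξ i * Real.exp (-∫ s in (t i)..(t n), ρ s)

/-- The model-V cost `C^V(ξ, t) = Σ_{n=0}^N λ(t_n) [G((E_n + ξ_n)/λ(t_n)) − G(E_n/λ(t_n))]`. -/
noncomputable def CVg (f ρ lam Finv : ℝ → ℝ) (N : ℕ) (t : ℕ → ℝ)
    (ξ : Fin (N + 1) → ℝ) : ℝ :=
  ∑ n ∈ Finset.range (N + 1),
    lam (t n) * (Gfun f Finv ((Evol ρ t (pad ξ) n + pad ξ n) / lam (t n)) -
      Gfun f Finv (Evol ρ t (pad ξ) n / lam (t n)))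

section PriceImpact

variable {f Finv : ℝ → ℝ}

theorem hasDerivAt_Fint (hf : Continuous f) (x : ℝ) : HasDerivAt (Fint f) (f x) x :=
  intervalIntegral.integral_hasDerivAt_right (hf.intervalIntegrable _ _)
    (hf.stronglyMeasurableAtFilter _ _) hf.continuousAt

theorem hasDerivAt_Ftil (hf : Continuous f) (x : ℝ) : HasDerivAt (Ftil f) (x * f x) x :=
  have hg : Continuous fun y => y * f y := continuous_id.mul hf
  intervalIntegral.integral_hasDerivAt_right (hg.intervalIntegrable _ _)
    (hg.stronglyMeasurableAtFilter _ _) hg.continuousAt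

theorem strictMono_Fint (hf : Continuous f) (hfpos : ∀ x, 0 < f x) : StrictMono (Fint f) :=
  strictMono_of_deriv_pos fun x => by simpa [(hasDerivAt_Fint hf x).deriv] using hfpos x

theorem continuous_inverse_Fint (hf : Continuous f) (hfpos : ∀ x, 0 < f x)
    (hFinv1 : ∀ y, Fint f (Finv y) = y) (hFinv2 : ∀ y, Finv (Fint f y) = y) :
    Continuous Finv := by
  have hmono : Monotone Finv := fun x y hxy => by
    rwa [← (strictMono_Fint hf hfpos).le_iff_le, hFinv1, hFinv1]
  exact hmono.continuous_of_surjective fun y => ⟨Fint f y, hFinv2 y⟩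

theorem hasDerivAt_Gfun (hf : Continuous f) (hfpos : ∀ x, 0 < f x)
    (hFinv1 : ∀ y, Fint f (Finv y) = y) (hFinv2 : ∀ y, Finv (Fint f y) = y) (x : ℝ) :
    HasDerivAt (Gfun f Finv) (Finv x) x := by
  have hinv : HasDerivAt Finv (f (Finv x))⁻¹ x :=
    (hasDerivAt_Fint hf (Finv x)).of_local_left_inverse
      (continuous_inverse_Fint hf hfpos hFinv1 hFinv2).continuousAt (hfpos _).ne'
      (Eventually.of_forall hFinv1)
  have h := (hasDerivAt_Ftil hf (Finv x)).comp x hinv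
  rwa [mul_assoc, mul_inv_cancel₀ (hfpos _).ne', mul_one] at h

theorem contDiff_Gfun (hf : Continuous f) (hfpos : ∀ x, 0 < f x)
    (hFinv1 : ∀ y, Fint f (Finv y) = y) (hFinv2 : ∀ y, Finv (Fint f y) = y) :
    ContDiff ℝ 1 (Gfun f Finv) := by
  have hG := hasDerivAt_Gfun hf hfpos hFinv1 hFinv2
  rw [contDiff_one_iff_deriv]
  refine ⟨fun x => (hG x).differentiableAt, ?_⟩
  rw [funext fun x => (hG x).deriv]
  exact continuous_inverse_Fint hf hfpos hFinv1 hFinv2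

end PriceImpact

/-- The coordinate `ξ ↦ pad ξ n` as a continuous linear map. -/
noncomputable def padCLM (N n : ℕ) : (Fin (N + 1) → ℝ) →L[ℝ] ℝ :=
  if h : n < N + 1 then ContinuousLinearMap.proj ⟨n, h⟩ else 0

@[simp]
theorem padCLM_apply {N : ℕ} (n : ℕ) (ξ : Fin (N + 1) → ℝ) : padCLM N n ξ = pad ξ n := by
  unfold padCLM pad
  split_ifs <;> simp

theorem pad_single {N i : ℕ} (hi : i < N + 1) (c : ℝ) (n : ℕ) :
    pad (Pi.single ⟨i, hi⟩ c : Fin (N + 1) → ℝ) n = if n = i then c else 0 := by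
  unfold pad
  split_ifs with h h' h'
  · subst h'; simp
  · simp [h']
  · omega
  · rfl

/-- The volume impact `ξ ↦ E_n` as a continuous linear map. -/
noncomputable def EvolCLM (ρ : ℝ → ℝ) (t : ℕ → ℝ) (N n : ℕ) : (Fin (N + 1) → ℝ) →L[ℝ] ℝ :=
  ∑ i ∈ Finset.range n, Real.exp (-∫ s in (t i)..(t n), ρ s) • padCLM N i

@[simp]
theorem EvolCLM_apply (ρ : ℝ → ℝ) (t : ℕ → ℝ) {N : ℕ} (n : ℕ) (ξ : Fin (N + 1) → ℝ) :
    EvolCLM ρ t N n ξ = Evol ρ t (pad ξ) n := by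
  simp [EvolCLM, Evol, mul_comm]

theorem Evol_pad_single (ρ : ℝ → ℝ) (t : ℕ → ℝ) {N i : ℕ} (hi : i < N + 1) (n : ℕ) :
    Evol ρ t (pad (Pi.single ⟨i, hi⟩ 1 : Fin (N + 1) → ℝ)) n =
      if i < n then Real.exp (-∫ s in (t i)..(t n), ρ s) else 0 := by
  simp [Evol, pad_single]

theorem exp_neg_integral_succ {ρ : ℝ → ℝ} (hρ : Continuous ρ) (t : ℕ → ℝ) (i n : ℕ) :
    aC ρ t (i + 1) * Real.exp (-∫ s in (t (i + 1))..(t n), ρ s) =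
      Real.exp (-∫ s in (t i)..(t n), ρ s) := by
  rw [aC, ← Real.exp_add, Nat.add_sub_cancel, ← neg_add,
    intervalIntegral.integral_add_adjacent_intervals (hρ.intervalIntegrable _ _)
      (hρ.intervalIntegrable _ _)]

section Cost

variable {f ρ lam Finv : ℝ → ℝ} {N : ℕ} {t : ℕ → ℝ}

theorem contDiff_CVg (hG : ContDiff ℝ 1 (Gfun f Finv)) : ContDiff ℝ 1 (CVg f ρ lam Finv N t) := by
  unfold CVg
  simp only [← EvolCLM_apply, ← padCLM_apply]
  refine ContDiff.sum fun n _ => contDiff_const.mul (ContDiff.sub (hG.comp ?_) (hG.comp ?_))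
  · exact ((EvolCLM ρ t N n).contDiff.add (padCLM N n).contDiff).div_const _
  · exact (EvolCLM ρ t N n).contDiff.div_const _

theorem fderiv_CVg_apply (hG : ∀ x, HasDerivAt (Gfun f Finv) (Finv x) x)
    (hlam : ∀ n ≤ N, lam (t n) ≠ 0) (ξ v : Fin (N + 1) → ℝ) :
    fderiv ℝ (CVg f ρ lam Finv N t) ξ v =
      ∑ n ∈ Finset.range (N + 1),
        (Finv ((Evol ρ t (pad ξ) n + pad ξ n) / lam (t n)) * (Evol ρ t (pad v) n + pad v n) -
          Finv (Evol ρ t (pad ξ) n / lam (t n)) * Evol ρ t (pad v) n) := by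
  have key (n : ℕ) (L : (Fin (N + 1) → ℝ) →L[ℝ] ℝ) :
      HasFDerivAt (fun ξ => Gfun f Finv (L ξ / lam (t n)))
        (Finv (L ξ / lam (t n)) • (lam (t n))⁻¹ • L) ξ := by
    refine (hG _).comp_hasFDerivAt ξ ?_
    simpa only [div_eq_inv_mul] using L.hasFDerivAt.const_mul (lam (t n))⁻¹
  have hC : CVg f ρ lam Finv N t = fun ξ => ∑ n ∈ Finset.range (N + 1),
      lam (t n) * (Gfun f Finv ((EvolCLM ρ t N n + padCLM N n) ξ / lam (t n)) -
        Gfun f Finv (EvolCLM ρ t N n ξ / lam (t n))) := by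
    funext ξ
    simp [CVg]
  rw [hC, (HasFDerivAt.fun_sum fun n _ =>
    ((key n (EvolCLM ρ t N n + padCLM N n)).fun_sub (key n (EvolCLM ρ t N n))).const_mul
      (lam (t n))).fderiv, sum_apply]
  refine Finset.sum_congr rfl fun n hn => ?_
  have hn' := hlam n (Nat.lt_succ_iff.mp (Finset.mem_range.mp hn))
  simp only [smul_apply, sub_apply,
    add_apply, EvolCLM_apply, padCLM_apply, smul_eq_mul]
  field_simp

end Cost

theorem stmt8 (f ρ lam Finv : ℝ → ℝ)
    (hf : Continuous f) (hfpos : ∀ x, 0 < f x)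
    (hFbot : Tendsto (Fint f) atBot atBot) (hFtop : Tendsto (Fint f) atTop atTop)
    (hFinv1 : ∀ y, Fint f (Finv y) = y) (hFinv2 : ∀ y, Finv (Fint f y) = y)
    (hρ : ContDiff ℝ 1 ρ) (hρpos : ∀ s, 0 ≤ s → 0 < ρ s)
    (hlam : ContDiff ℝ 2 lam) (hlampos : ∀ s, 0 ≤ s → 0 < lam s)
    (N : ℕ) (hN : 1 ≤ N) (t : ℕ → ℝ) (ht0 : t 0 = 0)
    (htmono : ∀ i, i < N → t i < t (i + 1)) :
    ContDiff ℝ 1 (CVg f ρ lam Finv N t) ∧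
    (∀ ξ : Fin (N + 1) → ℝ,
      fderiv ℝ (CVg f ρ lam Finv N t) ξ (Pi.single (Fin.last N) 1) =
        Finv ((Evol ρ t (pad ξ) N + pad ξ N) / lam (t N))) ∧
    (∀ ξ : Fin (N + 1) → ℝ, ∀ i : ℕ, ∀ hi : i < N,
      fderiv ℝ (CVg f ρ lam Finv N t) ξ (Pi.single ⟨i, by omega⟩ 1) -
        aC ρ t (i + 1) * fderiv ℝ (CVg f ρ lam Finv N t) ξ (Pi.single ⟨i + 1, by omega⟩ 1) =
      Finv ((Evol ρ t (pad ξ) i + pad ξ i) / lam (t i)) -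
        aC ρ t (i + 1) * Finv (Evol ρ t (pad ξ) (i + 1) / lam (t (i + 1)))) := by
  have hG := hasDerivAt_Gfun hf hfpos hFinv1 hFinv2
  have ht : ∀ n ≤ N, 0 ≤ t n := by
    intro n
    induction n with
    | zero => simp [ht0]
    | succ n ih => exact fun hn => (ih (by omega)).trans (htmono n (by omega)).le
  have hfderiv := fderiv_CVg_apply (ρ := ρ) hG fun n hn => (hlampos _ (ht n hn)).ne'
  refine ⟨contDiff_CVg (contDiff_Gfun hf hfpos hFinv1 hFinv2), fun ξ => ?_, fun ξ i hi => ?_⟩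
  · rw [hfderiv, Finset.sum_eq_single_of_mem N (by simp)]
    · simp [Fin.last, Evol_pad_single, pad_single]
    · intro n hn hnN
      have : ¬ N < n := by have := Finset.mem_range.mp hn; omega
      simp [Fin.last, Evol_pad_single, pad_single, hnN, this]
  · rw [hfderiv, hfderiv, Finset.mul_sum, ← Finset.sum_sub_distrib,
      Finset.sum_eq_add_of_mem i (i + 1) (by simp; omega) (by simp; omega) (by omega)]
    · simp only [Evol_pad_single, pad_single]
      simp [aC]
      ring
    · intro n _ hn
      simp only [Evol_pad_single, pad_single, hn.1, hn.2, if_false,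
        ← exp_neg_integral_succ hρ.continuous t i n]
      by_cases h : i + 1 < n
      · rw [if_pos (by omega), if_pos h]
        ring
      · rw [if_neg (by omega), if_neg h]
        ring
end

section
/- Let a, a' ∈ (0,1) and ã, ã' ∈ (0,1], and suppose f is nondecreasing on (−∞,0] and nonincreasing on [0,∞). Define h(x) = (F⁻¹(x) − a·F⁻¹(ã x))/(1 − a) and h'(x) = (F⁻¹(x) − a'·F⁻¹(ã' x))/(1 − a') (both are increasing bijections of ℝ). If (1/ã)·(1−ã)/(1−a) ≥ (1−ã')/(1−a'), then for every ν ≥ 0 one has h'⁻¹(ν) ≥ ã·h⁻¹(ν), and for every ν ≤ 0 one has h'⁻¹(ν) ≤ ã·h⁻¹(ν). -/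
open MeasureTheory Filter

/-- `h(x) = (F⁻¹(x) − a·F⁻¹(ã x))/(1 − a)`, where `Finv` plays the role of `F⁻¹`. -/
noncomputable def hFun (Finv : ℝ → ℝ) (a atil x : ℝ) : ℝ :=
  (Finv x - a * Finv (atil * x)) / (1 - a)

theorem Fint_zero (f : ℝ → ℝ) : Fint f 0 = 0 := by
  simp [Fint]

theorem Fint_sub (f : ℝ → ℝ) (hf : Continuous f) (p q : ℝ) :
    Fint f q - Fint f p = ∫ x in p..q, f x :=
  intervalIntegral.integral_interval_sub_left (hf.intervalIntegrable _ _)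
    (hf.intervalIntegrable _ _)

theorem Fint_strictMono (f : ℝ → ℝ) (hf : Continuous f) (hfpos : ∀ x, 0 < f x) :
    StrictMono (Fint f) := by
  intro p q hpq
  have h := intervalIntegral.intervalIntegral_pos_of_pos (hf.intervalIntegrable p q) hfpos hpq
  rw [← Fint_sub f hf] at h
  linarith

theorem Fint_neg_comp (f : ℝ → ℝ) (y : ℝ) : Fint (fun x => f (-x)) y = -Fint f (-y) := by
  simp only [Fint]
  rw [intervalIntegral.integral_comp_neg, neg_zero, intervalIntegral.integral_symm]

theorem Fint_sub_le (f : ℝ → ℝ) (hf : Continuous f) (hfanti : AntitoneOn f (Set.Ici 0))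
    {p q : ℝ} (hp : 0 ≤ p) (hq : 0 ≤ q) : Fint f q - Fint f p ≤ f p * (q - p) := by
  rcases le_total p q with h | h
  · have := intervalIntegral.integral_mono_on h (hf.intervalIntegrable p q)
      (continuous_const.intervalIntegrable (μ := volume) p q : IntervalIntegrable
        (fun _ => f p) volume p q)
      (fun x hx => hfanti hp (hp.trans hx.1) hx.1)
    rw [← Fint_sub f hf, intervalIntegral.integral_const, smul_eq_mul] at this
    linarith
  · have := intervalIntegral.integral_mono_on h
      (continuous_const.intervalIntegrable (μ := volume) q p : IntervalIntegrable
        (fun _ => f p) volume q p) (hf.intervalIntegrable q p)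
      (fun x hx => hfanti (hq.trans hx.1) hp hx.2)
    rw [← Fint_sub f hf, intervalIntegral.integral_const, smul_eq_mul] at this
    linarith

theorem hFun_neg {G : ℝ → ℝ} (hG : StrictMono G) (hG0 : G 0 = 0) {a b x : ℝ}
    (ha : a ∈ Set.Ioo (0:ℝ) 1) (hb : b ∈ Set.Ioc (0:ℝ) 1) (hx : x < 0) :
    hFun G a b x < 0 := by
  obtain ⟨ha0, ha1⟩ := ha
  obtain ⟨hb0, hb1⟩ := hb
  have h1 : G x ≤ G (b * x) := hG.monotone (by nlinarith)
  have h2 : G (b * x) < 0 := hG0 ▸ hG (mul_neg_of_pos_of_neg hb0 hx)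
  exact div_neg_of_neg_of_pos (by nlinarith) (by linarith)

/-- On `[0, ∞)`, `hFun G a b` is strictly increasing if `G` has subgradient `k` there. -/
theorem hFun_strictMonoOn {G k : ℝ → ℝ} (hG : StrictMono G)
    (hk0 : ∀ s, 0 ≤ k s) (hk : ∀ s t, 0 ≤ s → 0 ≤ t → k s * (t - s) ≤ G t - G s)
    {a b : ℝ} (ha : a ∈ Set.Ioo (0:ℝ) 1) (hb : b ∈ Set.Ioc (0:ℝ) 1) :
    StrictMonoOn (hFun G a b) (Set.Ici 0) := by
  intro y hy w hw hyw
  rw [Set.mem_Ici] at hy hw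
  obtain ⟨ha0, ha1⟩ := ha
  obtain ⟨hb0, hb1⟩ := hb
  have hby : 0 ≤ b * y := by positivity
  have hbw : 0 ≤ b * w := by positivity
  have hkmono : ∀ s t, 0 ≤ s → s < t → k s ≤ k t := by
    intro s t hs hst
    have h1 := hk s t hs (hs.trans hst.le)
    have h2 := hk t s (hs.trans hst.le) hs
    by_contra! h
    nlinarith [mul_pos (sub_pos.2 h) (sub_pos.2 hst)]
  have key : G (b * w) - G (b * y) ≤ G w - G y := by
    rcases lt_or_ge y (b * w) with h | h
    · have h1 := hk (b * w) w hbw hw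
      have h2 := hk y (b * y) hy hby
      have h3 : k y * ((1 - b) * y) ≤ k (b * w) * ((1 - b) * w) :=
        mul_le_mul (hkmono _ _ hy h) (mul_le_mul_of_nonneg_left hyw.le (by linarith))
          (mul_nonneg (by linarith) hy) (hk0 _)
      linarith
    · have h1 := hk (b * w) (b * y) hbw hby
      have h2 := hk y w hy hw
      have h0 : k (b * w) ≤ k y := by
        rcases h.eq_or_lt with h | h
        · rw [h]
        · exact hkmono _ _ hbw h
      have h3 : k (b * w) * (b * (w - y)) ≤ k y * (w - y) :=
        mul_le_mul h0 (by nlinarith) (mul_nonneg hb0.le (by linarith)) (hk0 _)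
      linarith
  have hlt := hG hyw
  apply div_lt_div_of_pos_right _ (by linarith : 0 < 1 - a)
  nlinarith

theorem hFun_mul_le {G k : ℝ → ℝ}
    (hk0 : ∀ s, 0 ≤ k s) (hk : ∀ s t, 0 ≤ s → 0 ≤ t → k s * (t - s) ≤ G t - G s)
    {a b a' b' : ℝ} (ha : a ∈ Set.Ioo (0:ℝ) 1) (hb : b ∈ Set.Ioc (0:ℝ) 1)
    (ha' : a' ∈ Set.Ioo (0:ℝ) 1) (hb' : b' ∈ Set.Ioc (0:ℝ) 1)
    (hineq : (1 - b') / (1 - a') ≤ (1 / b) * ((1 - b) / (1 - a))) {z : ℝ} (hz : 0 ≤ z) :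
    hFun G a' b' (b * z) ≤ hFun G a b z := by
  obtain ⟨ha0, ha1⟩ := ha
  obtain ⟨hb0, hb1⟩ := hb
  obtain ⟨ha0', ha1'⟩ := ha'
  obtain ⟨hb0', hb1'⟩ := hb'
  have hw : 0 ≤ b * z := by positivity
  have h1 := hk (b * z) z hw hz
  have h2 := hk (b * z) (b' * (b * z)) hw (by positivity)
  have pa : 0 < 1 - a := by linarith
  have pa' : 0 < 1 - a' := by linarith
  have e1 : hFun G a b z = G (b * z) + (G z - G (b * z)) / (1 - a) := by
    unfold hFun; field_simp; ring
  have e2 : hFun G a' b' (b * z) =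
      G (b * z) + a' * ((G (b * z) - G (b' * (b * z))) / (1 - a')) := by
    unfold hFun; field_simp; ring
  have i1 : k (b * z) * (z - b * z) / (1 - a) ≤ (G z - G (b * z)) / (1 - a) :=
    div_le_div_of_nonneg_right h1 pa.le
  have i2 : (G (b * z) - G (b' * (b * z))) / (1 - a') ≤
      k (b * z) * ((1 - b') * (b * z)) / (1 - a') :=
    div_le_div_of_nonneg_right (by linarith) pa'.le
  have i3 : k (b * z) * ((1 - b') * (b * z)) / (1 - a') ≤
      k (b * z) * (z - b * z) / (1 - a) := by
    have := mul_le_mul_of_nonneg_left hineq (mul_nonneg (hk0 (b * z)) hw)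
    calc _ = k (b * z) * (b * z) * ((1 - b') / (1 - a')) := by ring
      _ ≤ _ := this
      _ = _ := by field_simp
  have i4 : 0 ≤ k (b * z) * ((1 - b') * (b * z)) / (1 - a') :=
    div_nonneg (mul_nonneg (hk0 _) (mul_nonneg (by linarith) hw)) pa'.le
  rw [e1, e2]
  have i5 := mul_le_mul_of_nonneg_left i2 ha0'.le
  nlinarith

theorem mul_le_of_hFun_eq {f G : ℝ → ℝ} (hf : Continuous f) (hfpos : ∀ x, 0 < f x)
    (hFG : ∀ y, Fint f (G y) = y) (hfanti : AntitoneOn f (Set.Ici 0))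
    {a b a' b' : ℝ} (ha : a ∈ Set.Ioo (0:ℝ) 1) (hb : b ∈ Set.Ioc (0:ℝ) 1)
    (ha' : a' ∈ Set.Ioo (0:ℝ) 1) (hb' : b' ∈ Set.Ioc (0:ℝ) 1)
    (hineq : (1 - b') / (1 - a') ≤ (1 / b) * ((1 - b) / (1 - a)))
    {ν y z : ℝ} (hν : 0 ≤ ν) (hy : hFun G a' b' y = ν) (hz : hFun G a b z = ν) :
    b * z ≤ y := by
  have hF := Fint_strictMono f hf hfpos
  have hG : StrictMono G := fun s t hst => hF.lt_iff_lt.1 (by rwa [hFG, hFG])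
  have hG0 : G 0 = 0 := hF.injective (by rw [hFG, Fint_zero])
  have hGnn : ∀ s, 0 ≤ s → 0 ≤ G s := fun s hs => hG0 ▸ hG.monotone hs
  have hk0 : ∀ s, 0 ≤ (f (G s))⁻¹ := fun s => (inv_pos.2 (hfpos _)).le
  have hk : ∀ s t, 0 ≤ s → 0 ≤ t → (f (G s))⁻¹ * (t - s) ≤ G t - G s := by
    intro s t hs ht
    have := Fint_sub_le f hf hfanti (hGnn s hs) (hGnn t ht)
    rw [hFG, hFG] at this
    rwa [inv_mul_le_iff₀ (hfpos _)]
  have hz0 : 0 ≤ z := by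
    by_contra! h
    linarith [hFun_neg hG hG0 ha hb h]
  have hy0 : 0 ≤ y := by
    by_contra! h
    linarith [hFun_neg hG hG0 ha' hb' h]
  by_contra! h
  have h1 := hFun_strictMonoOn (k := fun s => (f (G s))⁻¹) hG hk0 hk ha' hb' hy0
    (mul_nonneg hb.1.le hz0) h
  have h2 := hFun_mul_le (k := fun s => (f (G s))⁻¹) hk0 hk ha hb ha' hb' hineq hz0
  linarith

theorem hFun_reflect (G : ℝ → ℝ) (a b x : ℝ) :
    hFun (fun t => -G (-t)) a b (-x) = -hFun G a b x := by
  simp only [hFun, mul_neg, neg_neg]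
  ring

theorem stmt10 (f Finv : ℝ → ℝ)
    (hf : Continuous f) (hfpos : ∀ x, 0 < f x)
    (hFbot : Tendsto (Fint f) atBot atBot) (hFtop : Tendsto (Fint f) atTop atTop)
    (hFinv1 : ∀ y, Fint f (Finv y) = y) (hFinv2 : ∀ y, Finv (Fint f y) = y)
    (hfmono : MonotoneOn f (Set.Iic 0)) (hfanti : AntitoneOn f (Set.Ici 0))
    (a atil a' atil' : ℝ) (ha : a ∈ Set.Ioo (0:ℝ) 1) (hatil : atil ∈ Set.Ioc (0:ℝ) 1)
    (ha' : a' ∈ Set.Ioo (0:ℝ) 1) (hatil' : atil' ∈ Set.Ioc (0:ℝ) 1)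
    (hineq : (1 - atil') / (1 - a') ≤ (1 / atil) * ((1 - atil) / (1 - a))) :
    (∀ ν, 0 ≤ ν → ∀ y z, hFun Finv a' atil' y = ν → hFun Finv a atil z = ν →
      atil * z ≤ y) ∧
    (∀ ν, ν ≤ 0 → ∀ y z, hFun Finv a' atil' y = ν → hFun Finv a atil z = ν →
      y ≤ atil * z) := by
  refine ⟨fun ν hν y z hy hz => mul_le_of_hFun_eq hf hfpos hFinv1 hfanti ha hatil ha' hatil'
    hineq hν hy hz, fun ν hν y z hy hz => ?_⟩
  have h := mul_le_of_hFun_eq (f := fun x => f (-x)) (G := fun t => -Finv (-t))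
    (hf.comp continuous_neg) (fun x => hfpos _)
    (fun y => by rw [Fint_neg_comp, neg_neg, hFinv1, neg_neg])
    (fun p hp q hq hpq => hfmono (Set.mem_Iic.2 (neg_nonpos.2 hq))
      (Set.mem_Iic.2 (neg_nonpos.2 hp)) (neg_le_neg hpq))
    ha hatil ha' hatil' hineq (ν := -ν) (y := -y) (z := -z) (by linarith)
    (by rw [hFun_reflect, hy]) (by rw [hFun_reflect, hz])
  linarith
end

section
/- Let a ∈ (0,1) and b > 0 with ab ≤ 1. Then for every x ∈ ℝ one has G(x) − (1/b)·G(a b x) ≥ 0, and G(x) − (1/b)·G(a b x) → +∞ as |x| → +∞. -/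
open MeasureTheory Filter

lemma mul_Fint_sub_le_Ftil_sub {f : ℝ → ℝ} (hf : Continuous f) (hfnonneg : ∀ x, 0 ≤ f x)
    (u v : ℝ) : u * (Fint f v - Fint f u) ≤ Ftil f v - Ftil f u := by
  have hg : Continuous fun y => y * f y := continuous_id.mul hf
  have hF : Fint f v - Fint f u = ∫ y in u..v, f y :=
    intervalIntegral.integral_interval_sub_left (hf.intervalIntegrable _ _)
      (hf.intervalIntegrable _ _)
  have hFtil : Ftil f v - Ftil f u = ∫ y in u..v, y * f y :=
    intervalIntegral.integral_interval_sub_left (hg.intervalIntegrable _ _)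
      (hg.intervalIntegrable _ _)
  have hu : Continuous fun y => u * f y := continuous_const.mul hf
  rw [hF, hFtil, ← intervalIntegral.integral_const_mul]
  rcases le_total u v with h | h
  · exact intervalIntegral.integral_mono_on h (hu.intervalIntegrable _ _)
      (hg.intervalIntegrable _ _) fun y hy => mul_le_mul_of_nonneg_right hy.1 (hfnonneg y)
  · rw [intervalIntegral.integral_symm v u, intervalIntegral.integral_symm v u, neg_le_neg_iff]
    exact intervalIntegral.integral_mono_on h (hg.intervalIntegrable _ _)
      (hu.intervalIntegrable _ _) fun y hy => mul_le_mul_of_nonneg_right hy.2 (hfnonneg y)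

/-- `F⁻¹ y` is a subgradient of `G` at `y`. -/
lemma Gfun_add_mul_sub_le {f Finv : ℝ → ℝ} (hf : Continuous f) (hfnonneg : ∀ x, 0 ≤ f x)
    (hFinv : ∀ y, Fint f (Finv y) = y) (x y : ℝ) :
    Gfun f Finv y + Finv y * (x - y) ≤ Gfun f Finv x := by
  have h := mul_Fint_sub_le_Ftil_sub hf hfnonneg (Finv y) (Finv x)
  rw [hFinv, hFinv] at h
  unfold Gfun
  linarith

theorem stmt12 (f Finv : ℝ → ℝ)
    (hf : Continuous f) (hfpos : ∀ x, 0 < f x)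
    (hFbot : Tendsto (Fint f) atBot atBot) (hFtop : Tendsto (Fint f) atTop atTop)
    (hFinv1 : ∀ y, Fint f (Finv y) = y) (hFinv2 : ∀ y, Finv (Fint f y) = y)
    (a b : ℝ) (ha : a ∈ Set.Ioo (0:ℝ) 1) (hb : 0 < b) (hab : a * b ≤ 1) :
    (∀ x : ℝ, 0 ≤ Gfun f Finv x - (1 / b) * Gfun f Finv (a * b * x)) ∧
    Tendsto (fun x => Gfun f Finv x - (1 / b) * Gfun f Finv (a * b * x)) atTop atTop ∧
    Tendsto (fun x => Gfun f Finv x - (1 / b) * Gfun f Finv (a * b * x)) atBot atTop := by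
  have hsub := Gfun_add_mul_sub_le hf (fun x => (hfpos x).le) hFinv1
  have hF0 : Fint f 0 = 0 := by simp [Fint]
  have hFinv0 : Finv 0 = 0 := by simpa [hF0] using hFinv2 0
  have hG0 : Gfun f Finv 0 = 0 := by simp [Gfun, Ftil, hFinv0]
  have hGnonneg : ∀ x, 0 ≤ Gfun f Finv x := fun x => by
    simpa [hFinv0, hG0] using hsub x 0
  obtain ⟨ha0, ha1⟩ := ha
  have hscale : ∀ x, Gfun f Finv (a * b * x) ≤ a * b * Gfun f Finv x := fun x => by
    have h1 := mul_le_mul_of_nonneg_left (hsub x (a * b * x)) (mul_pos ha0 hb).le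
    have h2 := mul_le_mul_of_nonneg_left (hsub 0 (a * b * x)) (sub_nonneg.2 hab)
    rw [hG0] at h2
    linarith
  have hlower : ∀ x, (1 - a) * Gfun f Finv x ≤
      Gfun f Finv x - (1 / b) * Gfun f Finv (a * b * x) := fun x => by
    have h := mul_le_mul_of_nonneg_left (hscale x) (one_div_pos.2 hb).le
    have hcancel : 1 / b * (a * b * Gfun f Finv x) = a * Gfun f Finv x := by
      field_simp
    linarith
  have ha' : 0 < 1 - a := sub_pos.2 ha1
  refine ⟨fun x => (mul_nonneg ha'.le (hGnonneg x)).trans (hlower x), ?_, ?_⟩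
  · refine tendsto_atTop_mono hlower (Tendsto.const_mul_atTop ha' ?_)
    refine tendsto_atTop_mono (fun x => hsub x (Fint f 1)) ?_
    simp only [hFinv2, one_mul]
    exact tendsto_atTop_add_const_left _ _ (tendsto_atTop_add_const_right _ _ tendsto_id)
  · refine tendsto_atTop_mono hlower (Tendsto.const_mul_atTop ha' ?_)
    refine tendsto_atTop_mono (fun x => hsub x (Fint f (-1))) ?_
    simp only [hFinv2, neg_one_mul, neg_sub, sub_eq_add_neg (Fint f (-1))]
    exact tendsto_atTop_add_const_left _ _
      (tendsto_atTop_add_const_left _ _ tendsto_neg_atBot_atTop)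
end

section
/- Let a, a' ∈ (0,1) and ã, ã' ∈ (0,1]. If (1/ã)·(1−ã)/(1−a) ≥ (1−ã')/(1−a'), then (1−ã)/(1−aã) ≥ a'·(1−ã')/(1−a'ã'). -/
theorem stmt13 (a a' atil atil' : ℝ)
    (ha : a ∈ Set.Ioo (0:ℝ) 1) (ha' : a' ∈ Set.Ioo (0:ℝ) 1)
    (hatil : atil ∈ Set.Ioc (0:ℝ) 1) (hatil' : atil' ∈ Set.Ioc (0:ℝ) 1)
    (h : (1 - atil') / (1 - a') ≤ (1 / atil) * ((1 - atil) / (1 - a))) :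
    a' * ((1 - atil') / (1 - a' * atil')) ≤ (1 - atil) / (1 - a * atil) := by
  obtain ⟨ha0, ha1⟩ := ha
  obtain ⟨hb0, hb1⟩ := ha'
  obtain ⟨hx0, hx1⟩ := hatil
  obtain ⟨hy0, hy1⟩ := hatil'
  have hax : 0 < 1 - a * atil := by nlinarith
  have hby : 0 < 1 - a' * atil' := by nlinarith
  have ha : 0 < 1 - a := sub_pos.2 ha1
  have hb : 0 < 1 - a' := sub_pos.2 hb1
  rw [div_mul_div_comm, one_mul, div_le_div_iff₀ hb (mul_pos hx0 ha)] at h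
  rw [← mul_div_assoc, div_le_div_iff₀ hby hax]
  have hnonneg : 0 ≤ (1 - a') * ((1 - atil') * (atil * (1 - a))) :=
    mul_nonneg hb.le (mul_nonneg (sub_nonneg.2 hy1) (mul_pos hx0 ha).le)
  linarith
end
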